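/- Let S be a primitive sequence with curling number k which is not robust, so that S^{k+1} has a proper suffix of the form T^{k+1} for some nonempty sequence T. Then T^{k+1} is in fact a proper suffix of S^2. -/

import Mathlib

/-- `listPow Y k` is the sequence `Y` repeated `k` times (i.e. `Y^k`). -/
def listPow {α : Type*} (Y : List α) : ℕ → List α
  | 0 => []
  | k + 1 => Y ++ listPow Y k

/-- The curling number of a finite sequence `S`: the largest `k` such that
`S = X ++ Y^k` for some (possibly empty) `X` and nonempty `Y`. -/
noncomputable def CN {α : Type*} (S : List α) : ℕ :=
  sSup {k | ∃ X Y : List α, Y ≠ [] ∧ S = X ++ listPow Y k}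

/-- A nonempty sequence is primitive if it is not a power `T^i` with `i ≥ 2`. -/
def Primitive {α : Type*} (S : List α) : Prop :=
  S ≠ [] ∧ ∀ (T : List α) (i : ℕ), 2 ≤ i → S ≠ listPow T i

/-- `T` is a proper suffix of `S`: a suffix which is strictly shorter than `S`. -/
def ProperSuffix {α : Type*} (T S : List α) : Prop := T <:+ S ∧ T.length < S.length

/-- A sequence `S` with curling number `k` is robust if no proper suffix of
`S^(k+1)` has curling number `≥ k + 1`. -/
def Robust {α : Type*} (S : List α) : Prop :=
  ∀ T : List α, ProperSuffix T (listPow S (CN S + 1)) → CN T ≤ CN S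

theorem listPow_add {α : Type*} (Y : List α) (m n : ℕ) :
    listPow Y (m + n) = listPow Y m ++ listPow Y n := by
  induction m with
  | zero => simp [listPow]
  | succ m ih => rw [Nat.succ_add]; simp [listPow, ih]

theorem listPow_one {α : Type*} (Y : List α) : listPow Y 1 = Y := by
  simp [listPow]

theorem length_listPow {α : Type*} (Y : List α) (n : ℕ) :
    (listPow Y n).length = n * Y.length := by
  induction n with
  | zero => simp [listPow]
  | succ n ih => simp [listPow, ih, Nat.succ_mul, Nat.add_comm]

theorem listPow_suffix_listPow {α : Type*} (Y : List α) {m n : ℕ} (h : m ≤ n) :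
    listPow Y m <:+ listPow Y n := by
  obtain ⟨d, rfl⟩ := Nat.exists_eq_add_of_le' h
  exact ⟨listPow Y d, (listPow_add Y d m).symm⟩

/-- Two commuting sequences are powers of a common sequence. -/
theorem exists_listPow_of_append_comm {α : Type*} (A B : List α) (h : A ++ B = B ++ A) :
    ∃ (C : List α) (i j : ℕ), A = listPow C i ∧ B = listPow C j := by
  induction hn : A.length + B.length using Nat.strong_induction_on generalizing A B with
  | _ n ih =>
    wlog hle : A.length ≤ B.length generalizing A B
    · obtain ⟨C, i, j, hB, hA⟩ := this B A h.symm (by omega) (by omega)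
      exact ⟨C, j, i, hA, hB⟩
    rcases eq_or_ne A [] with rfl | hA
    · exact ⟨B, 0, 1, rfl, (listPow_one B).symm⟩
    obtain ⟨D, rfl⟩ : A <+: B :=
      List.prefix_of_prefix_length_le (List.prefix_append A B) (h ▸ List.prefix_append B A) hle
    have hpos := List.length_pos_iff.mpr hA
    obtain ⟨C, i, j, hi, hj⟩ := ih (A.length + D.length)
      (by simp only [List.length_append] at hn; omega) A D
      (by simpa [List.append_assoc] using h) rfl
    exact ⟨C, i, i + j, hi, by rw [listPow_add, ← hi, ← hj]⟩

theorem Primitive.append_ne_append {α : Type*} {A B : List α} (hP : Primitive (B ++ A))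
    (hA : A ≠ []) (hB : B ≠ []) : A ++ B ≠ B ++ A := by
  intro h
  obtain ⟨C, i, j, rfl, rfl⟩ := exists_listPow_of_append_comm A B h
  have hi : i ≠ 0 := by rintro rfl; exact hA rfl
  have hj : j ≠ 0 := by rintro rfl; exact hB rfl
  exact hP.2 C (j + i) (by omega) (listPow_add C j i).symm

/-- The square of a primitive sequence is not a suffix of a power of a shorter sequence. -/
theorem Primitive.not_sq_suffix_listPow {α : Type*} {S T : List α} (hP : Primitive S)
    (hT : T ≠ []) (hlt : T.length < S.length) (k : ℕ) :
    ¬ S ++ S <:+ listPow T (k + 1) := by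
  intro h
  have hpow : listPow T (k + 1) = listPow T k ++ T := by rw [listPow_add, listPow_one]
  obtain ⟨B, rfl⟩ : T <:+ S :=
    List.suffix_of_suffix_length_le (hpow ▸ List.suffix_append _ T)
      ((List.suffix_append S S).trans h) hlt.le
  have hB : B ≠ [] := by rintro rfl; simp at hlt
  have hTB : T ++ B <:+ listPow T (k + 1) := by
    have hk : B ++ T ++ B <:+ listPow T k := by
      rw [hpow, ← List.append_assoc] at h
      obtain ⟨X, hX⟩ := h
      rw [← List.append_assoc] at hX
      exact ⟨X, List.append_cancel_right hX⟩
    rw [List.append_assoc] at hk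
    exact ((List.suffix_append B _).trans hk).trans (listPow_suffix_listPow T k.le_succ)
  have hBT : B ++ T <:+ listPow T (k + 1) := (List.suffix_append _ _).trans h
  exact hP.append_ne_append hT hB
    ((List.suffix_of_suffix_length_le hTB hBT (by simp [Nat.add_comm])).eq_of_length
      (by simp [Nat.add_comm]))

/-- If a primitive sequence `S` with curling number `k` is not robust, so that `S^(k+1)`
has a proper suffix `T^(k+1)` with `T` nonempty, then `T^(k+1)` is in fact a proper
suffix of `S^2`. -/
theorem nonrobust_suffix_in_square {α : Type*} (S T : List α) (k : ℕ)
    (hP : Primitive S) (hk : CN S = k) (hT : T ≠ [])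
    (hsuf : ProperSuffix (listPow T (k + 1)) (listPow S (k + 1))) :
    ProperSuffix (listPow T (k + 1)) (listPow S 2) := by
  obtain ⟨hs, hl⟩ := hsuf
  have hlt : T.length < S.length := by
    simp only [length_listPow] at hl
    exact Nat.lt_of_mul_lt_mul_left hl
  rcases Nat.eq_zero_or_pos k with rfl | hkpos
  · refine ⟨hs.trans (listPow_suffix_listPow S (by omega)), ?_⟩
    simp only [length_listPow]
    omega
  have hS2 : listPow S 2 <:+ listPow S (k + 1) := listPow_suffix_listPow S (by omega)
  have hlen : (listPow T (k + 1)).length < (listPow S 2).length := by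
    by_contra! hge
    refine hP.not_sq_suffix_listPow hT hlt k ?_
    have h := List.suffix_of_suffix_length_le hS2 hs hge
    simpa [listPow] using h
  exact ⟨List.suffix_of_suffix_length_le hs hS2 hlen.le, hlen⟩
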